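/- For positive definite n×n Hermitian matrices ω₁, …, ω_{n-2} and arbitrary Hermitian matrices A, B with D(ω₁,…,ω_{n-2},A,A) > 0: equality D(ω₁,…,ω_{n-2},A,B)² = D(ω₁,…,ω_{n-2},A,A)·D(ω₁,…,ω_{n-2},B,B) holds if and only if A and B are linearly dependent over ℝ. -/

import Mathlib

open scoped ComplexOrder

/-- The mixed discriminant of `m` Hermitian `m × m` complex matrices: the full
polarization of the determinant, `D(A, …, A) = det A`. -/
noncomputable def mixedDisc {m : ℕ} (A : Fin m → Matrix (Fin m) (Fin m) ℂ) : ℝ :=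
  ((m.factorial : ℂ)⁻¹ *
    ∑ σ : Equiv.Perm (Fin m), (Matrix.of fun i j => A (σ j) i j).det).re

/-- `D(A₁, …, Aₙ, X, Y)` for a family of `n` matrices of size `n + 2` together
with two extra entries `X`, `Y`. -/
noncomputable def mixedDisc2 {n : ℕ} (A : Fin n → Matrix (Fin (n + 2)) (Fin (n + 2)) ℂ)
    (X Y : Matrix (Fin (n + 2)) (Fin (n + 2)) ℂ) : ℝ :=
  mixedDisc (Fin.snoc (Fin.snoc A X) Y)


namespace MixAux

open Matrix Equiv

abbrev Mat (m : ℕ) := Matrix (Fin m) (Fin m) ℂ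

/-- Symmetric double-sum formula. -/
lemma formula {m : ℕ} (A : Fin m → Mat m) :
    mixedDisc A = ((m.factorial : ℂ)⁻¹ * ∑ σ : Perm (Fin m), ∑ τ : Perm (Fin m),
      ((Perm.sign σ : ℤ) : ℂ) * ((Perm.sign τ : ℤ) : ℂ) * ∏ k, A k (τ k) (σ k)).re := by
  unfold mixedDisc
  congr 2
  rw [← Equiv.sum_comp (Equiv.inv (Perm (Fin m)))]
  refine Finset.sum_congr rfl fun σ _ => ?_
  rw [Matrix.det_apply', ← Equiv.sum_comp (Equiv.mulRight (σ⁻¹ : Perm (Fin m)))]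
  refine Finset.sum_congr rfl fun τ _ => ?_
  simp only [Equiv.coe_mulRight, Perm.sign_mul, Perm.sign_inv, Equiv.inv_apply, Matrix.of_apply]
  rw [← Equiv.prod_comp σ]
  simp [mul_comm]

lemma perm_inv {m : ℕ} (A : Fin m → Mat m) (π : Perm (Fin m)) :
    mixedDisc (fun k => A (π k)) = mixedDisc A := by
  unfold mixedDisc
  congr 2
  exact Equiv.sum_comp (Equiv.mulLeft π) (fun σ : Perm (Fin m) => (Matrix.of fun i j => A (σ j) i j).det)

lemma mul_left {m : ℕ} (A : Fin m → Mat m) (M : Mat m) :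
    mixedDisc (fun k => M * A k) = (M.det * ((m.factorial : ℂ)⁻¹ *
    ∑ σ : Equiv.Perm (Fin m), (Matrix.of fun i j => A (σ j) i j).det)).re := by
  unfold mixedDisc
  congr 1
  rw [mul_left_comm, Finset.mul_sum (a := M.det)]
  congr 1
  refine Finset.sum_congr rfl fun σ _ => ?_
  rw [← Matrix.det_mul]
  rfl

lemma transp {m : ℕ} (A : Fin m → Mat m) :
    (∑ σ : Equiv.Perm (Fin m), (Matrix.of fun i j => (A (σ j))ᵀ i j).det) =
    ∑ σ : Equiv.Perm (Fin m), (Matrix.of fun i j => A (σ j) i j).det := by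
  have key : ∀ A : Fin m → Mat m, (∑ σ : Equiv.Perm (Fin m), (Matrix.of fun i j => (A (σ j)) i j).det)
      = ∑ σ : Perm (Fin m), ∑ τ : Perm (Fin m),
      ((Perm.sign σ : ℤ) : ℂ) * ((Perm.sign τ : ℤ) : ℂ) * ∏ k, A k (τ k) (σ k) := by
    intro A
    rw [← Equiv.sum_comp (Equiv.inv (Perm (Fin m)))]
    refine Finset.sum_congr rfl fun σ _ => ?_
    rw [Matrix.det_apply', ← Equiv.sum_comp (Equiv.mulRight (σ⁻¹ : Perm (Fin m)))]
    refine Finset.sum_congr rfl fun τ _ => ?_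
    simp only [Equiv.coe_mulRight, Perm.sign_mul, Perm.sign_inv, Equiv.inv_apply, Matrix.of_apply]
    rw [← Equiv.prod_comp σ]
    simp [mul_comm]
  rw [key, key (fun k => (A k)ᵀ), Finset.sum_comm]
  refine Finset.sum_congr rfl fun σ _ => Finset.sum_congr rfl fun τ _ => ?_
  simp [mul_comm]

lemma congr_inv {m : ℕ} (A : Fin m → Mat m) (C : Mat m) :
    mixedDisc (fun k => Cᴴ * A k * C) = Complex.normSq C.det * mixedDisc A := by
  have h1 : mixedDisc (fun k => Cᴴ * A k * C) = mixedDisc (fun k => Cᴴ * (A k * C)) := by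
    simp only [Matrix.mul_assoc]
  have h2 : (∑ σ : Equiv.Perm (Fin m), (Matrix.of fun i j => (A (σ j) * C) i j).det) =
     C.det * ∑ σ : Equiv.Perm (Fin m), (Matrix.of fun i j => A (σ j) i j).det := by
    rw [← transp (fun k => A k * C), ← transp A, Finset.mul_sum]
    refine Finset.sum_congr rfl fun σ _ => ?_
    rw [← Matrix.det_transpose C, ← Matrix.det_mul]
    congr 1
    ext i j
    simp [Matrix.mul_apply, mul_comm]
  rw [h1, mul_left, h2, mixedDisc, Matrix.det_conjTranspose]
  rw [show (star C.det * ((m.factorial : ℂ)⁻¹ * (C.det * ∑ σ : Equiv.Perm (Fin m), (Matrix.of fun i j => A (σ j) i j).det)))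
    = (C.det * star C.det) * ((m.factorial : ℂ)⁻¹ * ∑ σ : Equiv.Perm (Fin m), (Matrix.of fun i j => A (σ j) i j).det) by ring]
  rw [show C.det * star C.det = ((Complex.normSq C.det : ℝ) : ℂ) from Complex.mul_conj _, Complex.re_ofReal_mul]

lemma submatrix_inv {m : ℕ} (A : Fin m → Mat m) (π : Perm (Fin m)) :
    mixedDisc (fun k => (A k).submatrix π π) = mixedDisc A := by
  unfold mixedDisc
  congr 2
  rw [← Equiv.sum_comp (Equiv.mulRight (π : Perm (Fin m)))]
  refine Finset.sum_congr rfl fun σ _ => ?_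
  rw [← Matrix.det_submatrix_equiv_self π (Matrix.of fun i j => A (σ j) i j)]
  rfl

lemma cons_add {m : ℕ} (A : Fin m → Mat (m+1)) (X Y : Mat (m+1)) :
    mixedDisc (Fin.cons (X + Y) A : Fin (m+1) → Mat (m+1)) =
    mixedDisc (Fin.cons X A : Fin (m+1) → Mat (m+1)) + mixedDisc (Fin.cons Y A : Fin (m+1) → Mat (m+1)) := by
  rw [formula, formula, formula, ← Complex.add_re, ← mul_add, ← Finset.sum_add_distrib]
  congr 2
  refine Finset.sum_congr rfl fun σ _ => ?_
  rw [← Finset.sum_add_distrib]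
  refine Finset.sum_congr rfl fun τ _ => ?_
  simp only [Fin.prod_univ_succ, Fin.cons_zero, Fin.cons_succ, Matrix.add_apply]
  ring

lemma cons_smul {m : ℕ} (A : Fin m → Mat (m+1)) (c : ℝ) (X : Mat (m+1)) :
    mixedDisc (Fin.cons (c • X) A : Fin (m+1) → Mat (m+1)) =
    c * mixedDisc (Fin.cons X A : Fin (m+1) → Mat (m+1)) := by
  rw [formula, formula, ← Complex.re_ofReal_mul, mul_left_comm, Finset.mul_sum (a := (c : ℂ))]
  congr 2
  refine Finset.sum_congr rfl fun σ _ => ?_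
  rw [Finset.mul_sum]
  refine Finset.sum_congr rfl fun τ _ => ?_
  simp only [Fin.prod_univ_succ, Fin.cons_zero, Fin.cons_succ, Matrix.smul_apply, Complex.real_smul]
  ring

/-- The functional in the first slot. -/
noncomputable def DL {m : ℕ} (A : Fin m → Mat (m+1)) : Mat (m+1) →ₗ[ℝ] ℝ where
  toFun X := mixedDisc (Fin.cons X A : Fin (m+1) → Mat (m+1))
  map_add' := cons_add A
  map_smul' c X := by simpa using cons_smul A c X

lemma DL_swap {m : ℕ} (A : Fin m → Mat (m+2)) (X Y : Mat (m+2)) :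
    DL (Fin.cons X A : Fin (m+1) → Mat (m+2)) Y = DL (Fin.cons Y A : Fin (m+1) → Mat (m+2)) X := by
  change mixedDisc _ = mixedDisc _
  rw [← perm_inv _ (Equiv.swap 0 1)]
  congr 1
  funext k
  refine Fin.cases ?_ (fun k => Fin.cases ?_ (fun k => ?_) k) k
  · simp
  · rw [show (Fin.succ 0 : Fin (m+2)) = 1 from rfl, Equiv.swap_apply_right]; rfl
  · rw [Equiv.swap_apply_of_ne_of_ne (by simp) (by simp [Fin.ext_iff])]; rfl

lemma DL_swap' {m : ℕ} (A : Fin m → Mat (m+3)) (X Y Z : Mat (m+3)) :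
    DL (Fin.cons X (Fin.cons Y A : Fin (m+1) → Mat (m+3)) : Fin (m+2) → Mat (m+3)) Z =
    DL (Fin.cons Y (Fin.cons X A : Fin (m+1) → Mat (m+3)) : Fin (m+2) → Mat (m+3)) Z := by
  change mixedDisc _ = mixedDisc _
  rw [← perm_inv _ (Equiv.swap (Fin.succ 0) (Fin.succ (Fin.succ 0)))]
  congr 1
  funext k
  refine Fin.cases ?_ (fun k => Fin.cases ?_ (fun k => Fin.cases ?_ (fun k => ?_) k) k) k
  · rw [Equiv.swap_apply_of_ne_of_ne (Fin.succ_ne_zero _).symm (Fin.succ_ne_zero _).symm]; rfl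
  · rw [Equiv.swap_apply_left]; rfl
  · rw [Equiv.swap_apply_right]; rfl
  · rw [Equiv.swap_apply_of_ne_of_ne (fun h => Fin.succ_ne_zero _ (Fin.succ_injective _ h))
      (fun h => Fin.succ_ne_zero _ (Fin.succ_injective _ (Fin.succ_injective _ h)))]; rfl

/-- `q A X Y = D(X, Y, A)`. -/
noncomputable def q {m : ℕ} (A : Fin m → Mat (m+2)) (X Y : Mat (m+2)) : ℝ :=
  DL (Fin.cons Y A : Fin (m+1) → Mat (m+2)) X

lemma q_symm {m : ℕ} (A : Fin m → Mat (m+2)) (X Y : Mat (m+2)) : q A X Y = q A Y X := DL_swap _ _ _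

lemma snoc_eq {m : ℕ} (A : Fin m → Mat (m+1)) (X : Mat (m+1)) :
    mixedDisc (Fin.snoc A X : Fin (m+1) → Mat (m+1)) = DL A X := by
  change _ = mixedDisc _
  rw [← perm_inv (Fin.cons X A : Fin (m+1) → Mat (m+1)) (finRotate (m+1)), Fin.snoc_eq_cons_rotate]

lemma DL_perm {m : ℕ} (A : Fin m → Mat (m+1)) (X : Mat (m+1)) (π : Perm (Fin m)) :
    DL (fun k => A (π k)) X = DL A X := by
  change mixedDisc _ = mixedDisc _
  rw [← perm_inv (Fin.cons X A : Fin (m+1) → Mat (m+1)) (Equiv.Perm.decomposeFin.symm (0, π))]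
  congr 1
  funext k
  refine Fin.cases ?_ (fun k => ?_) k <;> simp

lemma mixedDisc2_eq {m : ℕ} (A : Fin m → Mat (m+2)) (X Y : Mat (m+2)) :
    mixedDisc2 A X Y = q A X Y := by
  rw [mixedDisc2, snoc_eq, q, DL_swap]
  rw [← DL_perm (Fin.cons X A : Fin (m+1) → Mat (m+2)) Y (finRotate (m+1)), Fin.snoc_eq_cons_rotate]

lemma minor0 {m : ℕ} (A : Fin m → Mat (m+1)) :
    (m+1 : ℝ) * DL A (Matrix.single 0 0 1) =
      mixedDisc (fun k => (A k).submatrix Fin.succ Fin.succ) := by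
  change _ * mixedDisc _ = _
  rw [formula, formula]
  have key : (∑ σ : Perm (Fin (m+1)), ∑ τ : Perm (Fin (m+1)),
      ((Perm.sign σ : ℤ) : ℂ) * ((Perm.sign τ : ℤ) : ℂ) *
        ∏ k, (Fin.cons (Matrix.single 0 0 1) A : Fin (m+1) → Mat (m+1)) k (τ k) (σ k)) =
      ∑ σ : Perm (Fin m), ∑ τ : Perm (Fin m),
      ((Perm.sign σ : ℤ) : ℂ) * ((Perm.sign τ : ℤ) : ℂ) *
        ∏ k, (A k).submatrix Fin.succ Fin.succ (τ k) (σ k) := by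
    rw [← Equiv.sum_comp Equiv.Perm.decomposeFin.symm, Fintype.sum_prod_type]
    rw [Finset.sum_eq_single 0]
    · refine Finset.sum_congr rfl fun σ _ => ?_
      rw [← Equiv.sum_comp Equiv.Perm.decomposeFin.symm, Fintype.sum_prod_type]
      rw [Finset.sum_eq_single 0]
      · refine Finset.sum_congr rfl fun τ _ => ?_
        simp [Fin.prod_univ_succ, Equiv.Perm.decomposeFin.symm_sign]
      · intro p _ hp
        refine Finset.sum_eq_zero fun τ _ => ?_
        simp [Fin.prod_univ_succ, hp.symm]
      · simp
    · intro p _ hp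
      refine Finset.sum_eq_zero fun σ _ => Finset.sum_eq_zero fun τ _ => ?_
      simp [Fin.prod_univ_succ, hp.symm]
    · simp
  rw [key, ← Complex.re_ofReal_mul, ← mul_assoc]
  congr 2
  rw [Nat.factorial_succ]
  push_cast
  have h1 : (m + 1 : ℂ) ≠ 0 := by exact_mod_cast Nat.succ_ne_zero m
  have h2 : (m.factorial : ℂ) ≠ 0 := by exact_mod_cast Nat.factorial_ne_zero m
  field_simp

lemma minor {m : ℕ} (A : Fin m → Mat (m+1)) (i : Fin (m+1)) :
    (m+1 : ℝ) * DL A (Matrix.single i i 1) =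
      mixedDisc (fun k => (A k).submatrix i.succAbove i.succAbove) := by
  have h := minor0 (fun k => (A k).submatrix i.cycleRange.symm i.cycleRange.symm)
  have e : DL (fun k => (A k).submatrix i.cycleRange.symm i.cycleRange.symm) (Matrix.single 0 0 1)
      = DL A (Matrix.single i i 1) := by
    change mixedDisc _ = mixedDisc _
    rw [← submatrix_inv (Fin.cons (Matrix.single i i 1) A : Fin (m+1) → Mat (m+1)) i.cycleRange.symm]
    congr 1
    funext k
    refine Fin.cases ?_ (fun k => ?_) k
    · ext a b
      have h0 : ∀ a, i = i.cycleRange.symm a ↔ 0 = a := fun a => by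
        conv_lhs => lhs; rw [← Fin.cycleRange_symm_zero i]
        exact EmbeddingLike.apply_eq_iff_eq _
      simp only [Fin.cons_zero, Matrix.single_apply, Matrix.submatrix_apply, h0]
    · simp
  rw [← e, h]
  congr 1
  funext k
  ext a b
  simp

/-- minors of the two-slot form -/
lemma minor_q {m : ℕ} (A : Fin m → Mat (m+3)) (X Y : Mat (m+3)) (i : Fin (m+3)) :
    (m+3 : ℝ) * DL (Fin.cons X (Fin.cons Y A : Fin (m+1) → Mat (m+3)) : Fin (m+2) → Mat (m+3))
      (Matrix.single i i 1) =
      q (fun k => (A k).submatrix i.succAbove i.succAbove)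
       (X.submatrix i.succAbove i.succAbove) (Y.submatrix i.succAbove i.succAbove) := by
  have := minor (Fin.cons X (Fin.cons Y A : Fin (m+1) → Mat (m+3)) : Fin (m+2) → Mat (m+3)) i
  push_cast at this
  rw [show (m+3:ℝ) = m + 1 + 1 + 1 by ring, this]
  change mixedDisc _ = mixedDisc _
  congr 1
  funext k
  refine Fin.cases ?_ (fun k => Fin.cases ?_ (fun k => ?_) k) k <;> rfl

/-- Simultaneous diagonalization. -/
lemma simdiag {m : ℕ} (W X : Mat m) (hW : W.PosDef) (hX : X.IsHermitian) :
    ∃ (C : Mat m) (x : Fin m → ℝ), IsUnit C.det ∧ Cᴴ * W * C = 1 ∧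
      Cᴴ * X * C = Matrix.diagonal (fun i => (x i : ℂ)) := by
  obtain ⟨S, hS⟩ : ∃ S : Mat m, W = Sᴴ * S := by
    open scoped MatrixOrder in
    exact CStarAlgebra.nonneg_iff_eq_star_mul_self.mp hW.posSemidef.nonneg
  have hSu : IsUnit S.det := by
    have h := hW.det_pos.ne'
    rw [hS, Matrix.det_mul] at h
    exact (right_ne_zero_of_mul h).isUnit
  have hY : ((S⁻¹)ᴴ * X * S⁻¹).IsHermitian := Matrix.isHermitian_conjTranspose_mul_mul _ hX
  have hU := hY.conjStarAlgAut_star_eigenvectorUnitary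
  rw [Unitary.conjStarAlgAut_star_apply] at hU
  have hUU : (hY.eigenvectorUnitary : Mat m)ᴴ * (hY.eigenvectorUnitary : Mat m) = 1 :=
    Unitary.coe_star_mul_self hY.eigenvectorUnitary
  set U : Mat m := (hY.eigenvectorUnitary : Mat m) with hUdef
  refine ⟨S⁻¹ * U, hY.eigenvalues, ?_, ?_, ?_⟩
  · rw [Matrix.det_mul]
    refine (Matrix.isUnit_nonsing_inv_det _ hSu).mul ?_
    have := congrArg Matrix.det hUU
    rw [Matrix.det_mul, Matrix.det_one] at this
    exact IsUnit.of_mul_eq_one_right _ this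
  · have h1 : S * S⁻¹ = 1 := Matrix.mul_nonsing_inv _ hSu
    have h2 : (S⁻¹)ᴴ * Sᴴ = 1 := by rw [← Matrix.conjTranspose_mul, h1, Matrix.conjTranspose_one]
    calc (S⁻¹ * U)ᴴ * W * (S⁻¹ * U) = Uᴴ * (((S⁻¹)ᴴ * Sᴴ) * (S * S⁻¹)) * U := by
          rw [hS, Matrix.conjTranspose_mul]; simp only [Matrix.mul_assoc]
      _ = 1 := by rw [h1, h2, Matrix.mul_one, Matrix.mul_one, hUU]
  · rw [Matrix.conjTranspose_mul]
    calc Uᴴ * (S⁻¹)ᴴ * X * (S⁻¹ * U) = Uᴴ * ((S⁻¹)ᴴ * X * S⁻¹) * U := by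
          simp only [Matrix.mul_assoc]
      _ = _ := hU

lemma one_eq_sum {m : ℕ} : (1 : Mat m) = ∑ i, Matrix.single i i (1:ℂ) := by
  ext a b
  simp [Matrix.sum_apply, Matrix.single_apply, Matrix.one_apply, ite_and]

lemma diag_eq_sum {m : ℕ} (x : Fin m → ℝ) :
    Matrix.diagonal (fun i => (x i : ℂ)) = ∑ i, x i • Matrix.single i i (1:ℂ) := by
  ext a b
  simp [Matrix.sum_apply, Matrix.single_apply, Matrix.diagonal_apply, ite_and]

lemma posdef_minor {m : ℕ} {W : Mat (m+1)} (hW : W.PosDef) (i : Fin (m+1)) :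
    (W.submatrix i.succAbove i.succAbove).PosDef :=
  hW.submatrix Fin.succAbove_right_injective

lemma posdef_congr {m : ℕ} {W C : Mat m} (hW : W.PosDef) (hC : IsUnit C.det) :
    (Cᴴ * W * C).PosDef :=
  hW.conjTranspose_mul_mul_same (Matrix.mulVec_injective_iff_isUnit.2 ((Matrix.isUnit_iff_isUnit_det _).2 hC))

lemma mixedDisc_pos : ∀ {m : ℕ} (A : Fin m → Mat m), (∀ i, (A i).PosDef) → 0 < mixedDisc A := by
  intro m
  induction m with
  | zero => intro A _; simp [mixedDisc]
  | succ m ih =>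
    intro A hA
    obtain ⟨C, x, hC, h1, -⟩ := simdiag (A 0) (A 0) (hA 0) (hA 0).1
    have hc : 0 < Complex.normSq C.det := Complex.normSq_pos.2 hC.ne_zero
    have h := congr_inv A C
    have h2 : mixedDisc (fun k => Cᴴ * A k * C) = DL (fun k : Fin m => Cᴴ * A k.succ * C) 1 := by
      change _ = mixedDisc _
      congr 1
      funext k
      refine Fin.cases ?_ (fun k => ?_) k
      · simpa using h1
      · simp
    have h3 : 0 < DL (fun k : Fin m => Cᴴ * A k.succ * C) 1 := by
      rw [one_eq_sum, map_sum]
      refine Finset.sum_pos (fun i _ => ?_) Finset.univ_nonempty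
      have := minor (fun k : Fin m => Cᴴ * A k.succ * C) i
      have h4 := ih (fun k => (Cᴴ * A k.succ * C).submatrix i.succAbove i.succAbove)
        (fun k => posdef_minor (posdef_congr (hA _) hC) i)
      rw [← this] at h4
      exact pos_of_mul_pos_right h4 (by positivity)
    rw [← h2, h] at h3
    exact pos_of_mul_pos_right h3 hc.le

end MixAux

namespace MixAux

lemma quad_cs (a b c : ℝ) (h : ∀ t : ℝ, 0 ≤ a + 2 * b * t + c * t ^ 2) : b ^ 2 ≤ a * c := by
  have := discrim_le_zero (a := c) (b := 2 * b) (c := a) (fun t => by have := h t; nlinarith)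
  unfold discrim at this
  nlinarith

/-- Abstract Bochner-type lemma. -/
lemma bochner {V : Type*} [AddCommGroup V] [Module ℝ V] (ip : V →ₗ[ℝ] V →ₗ[ℝ] ℝ)
    (symm : ∀ x y, ip x y = ip y x) (pos : ∀ x, 0 ≤ ip x x) (T : V →ₗ[ℝ] V)
    (Tsymm : ∀ x y, ip x (T y) = ip (T x) y)
    (h1 : ∀ x, ip x (T x) ≤ ip (T x) (T x)) (h2 : ∀ x, ip x (T x) ≤ ip x x)
    (e : V) (he : T e = e) (hsurj : ∀ x, ip e x = 0 → ∃ z, z - T z = x)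
    (x : V) (hx : ip e x = 0) (h0 : 0 ≤ ip x (T x)) : ip (T x) (T x) = 0 := by
  have np : ∀ x, ip e x = 0 → ip x (T x) ≤ 0 := by
    intro x hx
    obtain ⟨z, hz⟩ := hsurj x hx
    have cs := quad_cs (ip z (z - T z)) (ip x (z - T z)) (ip x (x - T x)) (fun t => by
      have := h2 (z + t • x)
      simp only [map_add, map_smul, LinearMap.add_apply, LinearMap.smul_apply, smul_eq_mul] at this
      simp only [map_sub]
      have s1 := symm x z
      have s2 := Tsymm z x
      have s3 := symm (T z) x
      rw [s2, s3, ← s1] at this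
      linear_combination this)
    have h3 : ip z (z - T z) ≤ ip x x := by
      rw [← hz]
      have := h1 z
      simp only [map_sub, LinearMap.sub_apply]
      have s2 := symm (T z) z
      linarith
    rw [hz] at cs h3
    have h4 : 0 ≤ ip x (x - T x) := by simpa using h2 x
    have h5 : ip x x ^ 2 ≤ ip x x * ip x (x - T x) := cs.trans (mul_le_mul_of_nonneg_right h3 h4)
    rcases (pos x).eq_or_lt with h | h
    · rw [h]; exact h2 x
    · have : ip x x ≤ ip x (x - T x) := by
        rw [sq] at h5
        exact le_of_mul_le_mul_left h5 h
      simp only [map_sub] at this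
      linarith
  have hTx : ip e (T x) = 0 := by rw [Tsymm, he, hx]
  have h00 : ip x (T x) = 0 := le_antisymm (np x hx) h0
  have cs := quad_cs (-ip x (T x)) (-ip (T x) (T x)) (-ip (T x) (T (T x))) (fun t => by
      have := np (x + t • T x) (by simp [hx, hTx])
      simp only [map_add, map_smul, LinearMap.add_apply, LinearMap.smul_apply, smul_eq_mul] at this
      have s2 := Tsymm x (T x)
      rw [s2] at this
      linear_combination this)
  rw [h00] at cs
  nlinarith

lemma linalg {ι : Type*} [Fintype ι] (Q : ι → ι → ℝ)
    (hs : ∀ i j, Q i j = Q j i) (hoff : ∀ i j, i ≠ j → 0 < Q i j)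
    (p : ι → ℝ) (hp : ∀ i, p i = ∑ j, Q i j) (hpos : ∀ i, 0 < p i)
    (hB : ∀ y : ι → ℝ, ∑ i, y i * ∑ j, Q i j * y j ≤ ∑ i, (∑ j, Q i j * y j) ^ 2 / p i)
    (x : ι → ℝ) (hx : ∑ i, p i * x i = 0) (h0 : 0 ≤ ∑ i, x i * ∑ j, Q i j * x j) :
    ∀ i, ∑ j, Q i j * x j = 0 := by
  let ip : (ι → ℝ) →ₗ[ℝ] (ι → ℝ) →ₗ[ℝ] ℝ := LinearMap.mk₂ ℝ (fun x y => ∑ i, p i * x i * y i)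
    (fun a b c => by simp only [Pi.add_apply, ← Finset.sum_add_distrib]; exact Finset.sum_congr rfl fun i _ => by ring)
    (fun r b c => by simp only [Pi.smul_apply, smul_eq_mul, Finset.mul_sum]; exact Finset.sum_congr rfl fun i _ => by ring)
    (fun a b c => by simp only [Pi.add_apply, ← Finset.sum_add_distrib]; exact Finset.sum_congr rfl fun i _ => by ring)
    (fun r b c => by simp only [Pi.smul_apply, smul_eq_mul, Finset.mul_sum]; exact Finset.sum_congr rfl fun i _ => by ring)
  have ipd : ∀ x y, ip x y = ∑ i, p i * x i * y i := fun _ _ => rfl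
  let T : (ι → ℝ) →ₗ[ℝ] (ι → ℝ) :=
    { toFun := fun x i => (∑ j, Q i j * x j) / p i
      map_add' := fun a b => by
        funext i; simp only [Pi.add_apply, mul_add, Finset.sum_add_distrib, add_div]
      map_smul' := fun r b => by
        funext i
        simp only [Pi.smul_apply, smul_eq_mul, RingHom.id_apply, ← mul_div_assoc, Finset.mul_sum]
        congr 1
        exact Finset.sum_congr rfl fun i _ => by ring }
  have Td : ∀ x i, T x i = (∑ j, Q i j * x j) / p i := fun _ _ => rfl
  have pT : ∀ x i, p i * T x i = ∑ j, Q i j * x j := fun x i => by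
    rw [Td]; exact mul_div_cancel₀ _ (hpos i).ne'
  have ipT : ∀ x y, ip x (T y) = ∑ i, x i * ∑ j, Q i j * y j := fun x y => by
    rw [ipd]; refine Finset.sum_congr rfl fun i _ => ?_
    rw [← pT]; ring
  have symm : ∀ x y, ip x y = ip y x := fun x y => by
    rw [ipd, ipd]; exact Finset.sum_congr rfl fun i _ => by ring
  have lap : ∀ x, ip x x - ip x (T x) = (∑ i, ∑ j, Q i j * (x i - x j) ^ 2) / 2 := by
    intro x
    have e1 : ip x x = ∑ i, ∑ j, Q i j * x i ^ 2 := by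
      rw [ipd]; refine Finset.sum_congr rfl fun i _ => ?_
      rw [hp, Finset.sum_mul, Finset.sum_mul]; exact Finset.sum_congr rfl fun i _ => by ring
    have e2 : ip x x = ∑ i, ∑ j, Q i j * x j ^ 2 := by
      rw [e1, Finset.sum_comm]
      exact Finset.sum_congr rfl fun i _ => Finset.sum_congr rfl fun j _ => by rw [hs]
    have e3 : ip x (T x) = ∑ i, ∑ j, Q i j * (x i * x j) := by
      rw [ipT]; refine Finset.sum_congr rfl fun i _ => ?_
      rw [Finset.mul_sum]; exact Finset.sum_congr rfl fun i _ => by ring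
    have e4 : ∑ i, ∑ j, Q i j * (x i - x j) ^ 2 = ∑ i, ∑ j, Q i j * x i ^ 2 +
        ∑ i, ∑ j, Q i j * x j ^ 2 - 2 * ∑ i, ∑ j, Q i j * (x i * x j) := by
      simp only [Finset.mul_sum, ← Finset.sum_add_distrib, ← Finset.sum_sub_distrib]
      exact Finset.sum_congr rfl fun i _ => Finset.sum_congr rfl fun j _ => by ring
    rw [e4, ← e1, ← e2, ← e3]; ring
  have nn : ∀ x : ι → ℝ, ∀ i j, 0 ≤ Q i j * (x i - x j) ^ 2 := by
    intro x i j
    by_cases h : i = j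
    · simp [h]
    · exact mul_nonneg (hoff i j h).le (sq_nonneg _)
  have h2 : ∀ x, ip x (T x) ≤ ip x x := by
    intro x
    have := lap x
    have : 0 ≤ ∑ i, ∑ j, Q i j * (x i - x j) ^ 2 :=
      Finset.sum_nonneg fun i _ => Finset.sum_nonneg fun j _ => nn x i j
    linarith
  have he : T (fun _ => 1) = fun _ => 1 := by
    funext i; rw [Td]; simp only [mul_one]; rw [← hp, div_self (hpos i).ne']
  have Tsymm : ∀ x y, ip x (T y) = ip (T x) y := by
    intro x y
    rw [symm (T x) y, ipT, ipT]
    simp only [Finset.mul_sum]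
    rw [Finset.sum_comm]
    exact Finset.sum_congr rfl fun i _ => Finset.sum_congr rfl fun j _ => by rw [hs]; ring
  have pos : ∀ x, 0 ≤ ip x x := fun x => Finset.sum_nonneg fun i _ => by
    rw [mul_assoc]; exact mul_nonneg (hpos i).le (mul_self_nonneg _)
  have pos0 : ∀ x, ip x x = 0 → x = 0 := by
    intro x h
    rw [ipd, Finset.sum_eq_zero_iff_of_nonneg (fun i _ => by
      rw [mul_assoc]; exact mul_nonneg (hpos i).le (mul_self_nonneg _))] at h
    funext i
    have := h i (Finset.mem_univ i)
    rw [mul_assoc] at this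
    simpa [(hpos i).ne'] using this
  let M : (ι → ℝ) →ₗ[ℝ] (ι → ℝ) := LinearMap.id - T + (ip (fun _ => 1)).smulRight (fun _ => (1:ℝ))
  have Md : ∀ z, M z = z - T z + (ip (fun _ => 1) z) • (fun _ => (1:ℝ)) := fun _ => rfl
  have Minj : Function.Injective M := by
    rw [← LinearMap.ker_eq_bot, LinearMap.ker_eq_bot']
    intro z hz
    have h := congrArg (ip z) hz
    rw [Md, map_add, map_sub, map_smul, symm z (fun _ => 1), lap, map_zero, smul_eq_mul] at h
    have a : 0 ≤ ∑ i, ∑ j, Q i j * (z i - z j) ^ 2 :=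
      Finset.sum_nonneg fun i _ => Finset.sum_nonneg fun j _ => nn z i j
    have b : ip (fun _ => 1) z = 0 := by nlinarith [mul_self_nonneg (ip (fun _ => 1) z)]
    have c : ∑ i, ∑ j, Q i j * (z i - z j) ^ 2 = 0 := by rw [b] at h; linarith
    rw [Finset.sum_eq_zero_iff_of_nonneg (fun i _ => Finset.sum_nonneg fun j _ => nn z i j)] at c
    have d : ∀ i j, z i = z j := by
      intro i j
      by_cases hij : i = j
      · rw [hij]
      have c1 := c i (Finset.mem_univ i)
      rw [Finset.sum_eq_zero_iff_of_nonneg (fun j _ => nn z i j)] at c1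
      have c2 := c1 j (Finset.mem_univ j)
      simp only [mul_eq_zero, (hoff i j hij).ne', false_or] at c2
      exact sub_eq_zero.1 (pow_eq_zero_iff (two_ne_zero) |>.1 c2)
    apply pos0
    rw [ipd] at b ⊢
    by_cases hne : Nonempty ι
    · obtain ⟨i0⟩ := hne
      have : ∑ i, p i * z i * z i = z i0 * ∑ i, p i * 1 * z i := by
        rw [Finset.mul_sum]
        refine Finset.sum_congr rfl fun i _ => ?_
        rw [d i i0]; ring
      rw [this, b, mul_zero]
    · rw [not_nonempty_iff] at hne; simp
  have hsurj : ∀ x, ip (fun _ => 1) x = 0 → ∃ z, z - T z = x := by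
    intro x hx
    obtain ⟨z, hz⟩ := (LinearMap.injective_iff_surjective.1 Minj) x
    refine ⟨z, ?_⟩
    have h := congrArg (ip (fun _ => 1)) hz
    rw [Md, map_add, map_sub, map_smul, Tsymm, he, hx, sub_self, zero_add, smul_eq_mul] at h
    rw [Md] at hz
    rcases mul_eq_zero.1 h with h | h
    · rw [h, zero_smul, add_zero] at hz; exact hz
    · have h3 := pos0 _ h
      rw [h3, smul_zero, add_zero] at hz; exact hz
  have key := bochner ip symm pos T Tsymm (fun x => by
      rw [ipT, ipd]
      refine (hB x).trans (le_of_eq (Finset.sum_congr rfl fun i _ => ?_))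
      rw [← pT]
      have := (hpos i).ne'
      field_simp) h2 (fun _ => 1) he hsurj x (by rw [ipd]; simpa using hx) (by rw [ipT]; exact h0)
  intro i
  rw [← pT, pos0 _ key]; simp

end MixAux

namespace MixAux

open Matrix

section qlin
variable {m : ℕ} (A : Fin m → Mat (m+2)) (X Y Z : Mat (m+2)) (c : ℝ)
lemma q_add_left : q A (X + Y) Z = q A X Z + q A Y Z := map_add _ _ _
lemma q_smul_left : q A (c • X) Z = c * q A X Z := map_smul (DL _) c X
lemma q_sub_left : q A (X - Y) Z = q A X Z - q A Y Z := map_sub _ _ _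
lemma q_add_right : q A Z (X + Y) = q A Z X + q A Z Y := by
  rw [q_symm, q_add_left, q_symm A X, q_symm A Y]
lemma q_smul_right : q A Z (c • X) = c * q A Z X := by
  rw [q_symm, q_smul_left, q_symm A X]
lemma q_sub_right : q A Z (X - Y) = q A Z X - q A Z Y := by
  rw [q_symm, q_sub_left, q_symm A X, q_symm A Y]
lemma q_zero_left : q A 0 Z = 0 := map_zero _
lemma q_sum_left {ι : Type*} (s : Finset ι) (f : ι → Mat (m+2)) :
    q A (∑ i ∈ s, f i) Z = ∑ i ∈ s, q A (f i) Z := map_sum (DL _) _ _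
lemma q_sum_right {ι : Type*} (s : Finset ι) (f : ι → Mat (m+2)) :
    q A Z (∑ i ∈ s, f i) = ∑ i ∈ s, q A Z (f i) := by
  rw [q_symm, q_sum_left]; exact Finset.sum_congr rfl fun i _ => q_symm _ _ _
end qlin

lemma q_congr {m : ℕ} (A : Fin m → Mat (m+2)) (X Y C : Mat (m+2)) :
    q (fun k => Cᴴ * A k * C) (Cᴴ * X * C) (Cᴴ * Y * C) = Complex.normSq C.det * q A X Y := by
  unfold q
  change mixedDisc _ = _ * mixedDisc _
  rw [← congr_inv]
  congr 1
  funext k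
  refine Fin.cases ?_ (fun k => Fin.cases ?_ (fun k => ?_) k) k <;> rfl

lemma herm_smul {m : ℕ} {X : Mat m} (hX : X.IsHermitian) (c : ℝ) : (c • X).IsHermitian := by
  rw [Matrix.IsHermitian, Matrix.conjTranspose_smul, hX.eq]; simp

def HR (n : ℕ) : Prop := ∀ ω : Fin n → Mat (n+2), (∀ i, (ω i).PosDef) →
  ∀ A B : Mat (n+2), A.IsHermitian → B.IsHermitian → 0 < q ω A A → q ω A B = 0 → 0 ≤ q ω B B → B = 0

def HRI (n : ℕ) : Prop := ∀ ω : Fin n → Mat (n+2), (∀ i, (ω i).PosDef) →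
  ∃ W : Mat (n+2), W.IsHermitian ∧ ∀ B : Mat (n+2), B.IsHermitian → q ω W B = 0 → 0 ≤ q ω B B → B = 0

lemma HR_of_HRI {n : ℕ} (h : HRI n) : HR n := by
  intro ω hω A B hA hB hAA hAB hBB
  obtain ⟨W, hW, h⟩ := h ω hω
  have hC := h (q ω W B • A - q ω W A • B) ((herm_smul hA _).sub (herm_smul hB _))
    (by rw [q_sub_right, q_smul_right, q_smul_right]; ring)
  have e : q ω (q ω W B • A - q ω W A • B) (q ω W B • A - q ω W A • B) =
      q ω W B ^ 2 * q ω A A + q ω W A ^ 2 * q ω B B := by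
    simp only [q_sub_right, q_smul_right, q_sub_left, q_smul_left, q_symm ω B A, hAB]
    ring
  have h1 := hC (by rw [e]; positivity)
  rw [h1, q_zero_left] at e
  have h2 : q ω W B = 0 := by
    by_contra hne
    have : 0 < q ω W B ^ 2 := by positivity
    nlinarith [mul_pos this hAA, mul_nonneg (sq_nonneg (q ω W A)) hBB]
  exact h B hB h2 hBB

lemma HR_ineq {n : ℕ} (h : HR n) (ω : Fin n → Mat (n+2)) (hω : ∀ i, (ω i).PosDef)
    (A X : Mat (n+2)) (hA : A.IsHermitian) (hX : X.IsHermitian) (hAA : 0 < q ω A A) :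
    q ω X X * q ω A A ≤ q ω A X ^ 2 := by
  set Z := q ω A A • X - q ω A X • A with hZ
  have h1 : q ω A Z = 0 := by rw [hZ, q_sub_right, q_smul_right, q_smul_right]; ring
  have h2 : q ω Z Z = q ω A A * (q ω X X * q ω A A - q ω A X ^ 2) := by
    rw [hZ]
    simp only [q_sub_right, q_smul_right, q_sub_left, q_smul_left, q_symm ω X A]
    ring
  by_contra hlt
  push Not at hlt
  have h3 : 0 < q ω Z Z := by rw [h2]; exact mul_pos hAA (by linarith)
  have h4 := h ω hω A Z hA ((herm_smul hX _).sub (herm_smul hA _)) hAA h1 h3.le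
  rw [h4, q_zero_left] at h3
  exact lt_irrefl _ h3

lemma sum_perm_two (f : Equiv.Perm (Fin 2) → ℂ) : ∑ σ, f σ = f 1 + f (Equiv.swap 0 1) := by
  have : (Finset.univ : Finset (Equiv.Perm (Fin 2))) = {1, Equiv.swap 0 1} := by decide
  rw [this, Finset.sum_pair (by decide)]

lemma HRI_zero : HRI 0 := by
  intro ω _
  refine ⟨1, Matrix.isHermitian_one, ?_⟩
  intro B hB h1 h2
  have e1 : q ω 1 B = (B 0 0 + B 1 1).re / 2 := by
    change mixedDisc (Fin.cons _ (Fin.cons _ _)) = _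
    rw [mixedDisc, sum_perm_two]
    simp [Matrix.det_fin_two, Nat.factorial]
    try ring
  have e2 : q ω B B = (B 0 0 * B 1 1 - B 0 1 * B 1 0).re := by
    change mixedDisc (Fin.cons _ (Fin.cons _ _)) = _
    rw [mixedDisc, sum_perm_two]
    simp [Matrix.det_fin_two, Nat.factorial]
    try ring
  have hij : ∀ i j, star (B i j) = B j i := fun i j => hB.apply j i
  have i00 : (B 0 0).im = 0 := by have := congrArg Complex.im (hij 0 0); simp at this; linarith
  have i11 : (B 1 1).im = 0 := by have := congrArg Complex.im (hij 1 1); simp at this; linarith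
  have r10 := hij 0 1
  rw [e2, ← r10] at h2
  rw [e1] at h1
  simp [i00, i11] at h1 h2
  have h3 : (B 1 1).re = - (B 0 0).re := by linarith
  rw [h3] at h2
  have a : (B 0 0).re = 0 := by nlinarith [sq_nonneg (B 0 0).re, sq_nonneg (B 0 1).re, sq_nonneg (B 0 1).im]
  have b : (B 0 1).re = 0 := by nlinarith [sq_nonneg (B 0 0).re, sq_nonneg (B 0 1).re, sq_nonneg (B 0 1).im]
  have c : (B 0 1).im = 0 := by nlinarith [sq_nonneg (B 0 0).re, sq_nonneg (B 0 1).re, sq_nonneg (B 0 1).im]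
  have z00 : B 0 0 = 0 := Complex.ext a i00
  have z11 : B 1 1 = 0 := Complex.ext (by rw [h3, a]; simp) i11
  have z01 : B 0 1 = 0 := Complex.ext b c
  have z10 : B 1 0 = 0 := by rw [← r10, z01]; simp
  ext i j
  fin_cases i <;> fin_cases j <;> simp [z00, z11, z01, z10]

lemma diag_herm {m : ℕ} (x : Fin m → ℝ) : (Matrix.diagonal (fun i => (x i : ℂ))).IsHermitian := by
  rw [Matrix.isHermitian_diagonal_iff]
  intro i; exact Complex.conj_ofReal _

/-- normalized step -/
lemma step_norm {n : ℕ} (ih : HR n) (ω : Fin n → Mat (n+3)) (hω : ∀ i, (ω i).PosDef)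
    (x : Fin (n+3) → ℝ)
    (h1 : q (Fin.cons 1 ω : Fin (n+1) → Mat (n+3)) 1 (Matrix.diagonal (fun i => (x i : ℂ))) = 0)
    (h2 : 0 ≤ q (Fin.cons 1 ω : Fin (n+1) → Mat (n+3)) (Matrix.diagonal (fun i => (x i : ℂ)))
      (Matrix.diagonal (fun i => (x i : ℂ)))) : x = 0 := by
  let E : Fin (n+3) → Mat (n+3) := fun i => Matrix.single i i 1
  let dg : (Fin (n+3) → ℝ) → Mat (n+3) := fun y => Matrix.diagonal (fun i => (y i : ℂ))
  let Ω : Fin (n+1) → Mat (n+3) := Fin.cons 1 ω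
  let D3 : Mat (n+3) → Mat (n+3) → Mat (n+3) → ℝ := fun X Y Z =>
    DL (Fin.cons Y (Fin.cons Z ω : Fin (n+1) → Mat (n+3)) : Fin (n+2) → Mat (n+3)) X
  have qD : ∀ X Y, q Ω X Y = D3 X Y 1 := fun _ _ => rfl
  have D3a : ∀ X Y Z, D3 X Y Z = D3 Y X Z := fun X Y Z => DL_swap _ _ _
  have D3b : ∀ X Y Z, D3 X Y Z = D3 X Z Y := fun X Y Z => DL_swap' _ _ _ _
  have dgs : ∀ y, dg y = ∑ i, y i • E i := fun y => diag_eq_sum y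
  have ones : (1 : Mat (n+3)) = ∑ i, E i := one_eq_sum
  -- minors
  let mi : Fin (n+3) → Mat (n+3) → Mat (n+2) := fun i X => X.submatrix i.succAbove i.succAbove
  let ωi : Fin (n+3) → Fin n → Mat (n+2) := fun i k => mi i (ω k)
  have hωi : ∀ i k, (ωi i k).PosDef := fun i k => posdef_minor (hω k) i
  have hmin : ∀ i X Y, (n+3 : ℝ) * D3 (E i) X Y = q (ωi i) (mi i X) (mi i Y) :=
    fun i X Y => minor_q ω X Y i
  have npos : (0:ℝ) < n + 3 := by positivity
  have one_pd : ∀ k, (1 : Mat k).PosDef := fun k => Matrix.PosDef.one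
  have mi1 : ∀ i, mi i 1 = 1 := fun i => Matrix.submatrix_one _ Fin.succAbove_right_injective
  have q1pos : ∀ i, 0 < q (ωi i) 1 1 := fun i => mixedDisc_pos _ (fun k => by
    refine Fin.cases ?_ (fun k => Fin.cases ?_ (fun k => ?_) k) k
    · exact one_pd _
    · exact one_pd _
    · exact hωi i k)
  let Q : Fin (n+3) → Fin (n+3) → ℝ := fun i j => q Ω (E i) (E j)
  let p : Fin (n+3) → ℝ := fun i => q Ω (E i) 1
  have hQy : ∀ i y, q Ω (E i) (dg y) = ∑ j, Q i j * y j := by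
    intro i y
    rw [dgs, q_sum_right]
    exact Finset.sum_congr rfl fun j _ => by rw [q_smul_right, mul_comm]
  have hyQ : ∀ y, q Ω (dg y) (dg y) = ∑ i, y i * ∑ j, Q i j * y j := by
    intro y
    conv_lhs => rw [dgs y, q_sum_left, ← dgs y]
    exact Finset.sum_congr rfl fun j _ => by rw [q_smul_left, hQy]
  have hyS : ∀ y, q Ω (dg y) (dg y) = ∑ i, D3 (E i) (dg y) (dg y) := by
    intro y
    rw [qD, D3b, D3a, ones]
    exact map_sum (DL _) _ _
  have hp : ∀ i, p i = ∑ j, Q i j := by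
    intro i
    change q Ω (E i) 1 = _
    rw [ones, q_sum_right]
  have pq : ∀ i, (n+3:ℝ) * p i = q (ωi i) 1 1 := by
    intro i
    rw [← mi1 i, ← hmin]; rfl
  have ppos : ∀ i, 0 < p i := fun i => by
    have := q1pos i
    rw [← pq] at this
    exact pos_of_mul_pos_right this npos.le
  have qy : ∀ i y, (n+3:ℝ) * ∑ j, Q i j * y j = q (ωi i) 1 (mi i (dg y)) := by
    intro i y
    rw [← mi1 i, ← hmin, D3b, ← qD, hQy]
  have hoff : ∀ i j, i ≠ j → 0 < Q i j := by
    intro i j hij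
    obtain ⟨k, hk⟩ := Fin.exists_succAbove_eq hij.symm
    have e : mi i (E j) = Matrix.single k k 1 := by
      ext a b
      simp [mi, E, Matrix.single_apply, ← hk]
    have h : (n+3:ℝ) * Q i j = q (ωi i) (Matrix.single k k 1) 1 := by
      rw [← mi1 i, ← e, ← hmin]; rfl
    have h' := minor (Fin.cons 1 (ωi i) : Fin (n+1) → Mat (n+2)) k
    have h'' : 0 < mixedDisc (fun l => ((Fin.cons 1 (ωi i) : Fin (n+1) → Mat (n+2)) l).submatrix
        k.succAbove k.succAbove) := mixedDisc_pos _ (fun l => posdef_minor (by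
          refine Fin.cases ?_ (fun l => ?_) l
          · exact one_pd _
          · exact hωi i l) k)
    rw [← h'] at h''
    have h3 : 0 < q (ωi i) (Matrix.single k k 1) 1 := pos_of_mul_pos_right h'' (by positivity)
    rw [← h] at h3
    exact pos_of_mul_pos_right h3 npos.le
  have hdgi : ∀ i y, (mi i (dg y)).IsHermitian := fun i y => (diag_herm y).submatrix _
  have hter : ∀ i y, D3 (E i) (dg y) (dg y) ≤ (∑ j, Q i j * y j) ^ 2 / p i := by
    intro i y
    have h := HR_ineq ih (ωi i) (hωi i) 1 (mi i (dg y)) (one_pd _).1 (hdgi i y) (q1pos i)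
    rw [← pq, ← qy, ← hmin] at h
    rw [le_div_iff₀ (ppos i)]
    have h' : (n+3:ℝ)^2 * (D3 (E i) (dg y) (dg y) * p i) ≤ (n+3:ℝ)^2 * (∑ j, Q i j * y j) ^ 2 := by
      linarith
    exact le_of_mul_le_mul_left h' (by positivity)
  have hL := linalg Q (fun i j => q_symm _ _ _) hoff p hp ppos (fun y => by
      rw [← hyQ, hyS]
      exact Finset.sum_le_sum fun i _ => hter i y) x (by
      have h1' : q Ω 1 (dg x) = 0 := h1
      rw [q_symm, dgs, q_sum_left] at h1'
      rw [← h1']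
      exact Finset.sum_congr rfl fun i _ => by rw [q_smul_left, mul_comm]) (by
      rw [← hyQ]; exact h2)
  have hsum : ∑ i, D3 (E i) (dg x) (dg x) = 0 := by
    rw [← hyS, hyQ]
    exact Finset.sum_eq_zero fun i _ => by rw [hL i, mul_zero]
  have hle : ∀ i, D3 (E i) (dg x) (dg x) ≤ 0 := fun i => by
    have := hter i x
    rwa [hL i, zero_pow two_ne_zero, zero_div] at this
  have hz : ∀ i, D3 (E i) (dg x) (dg x) = 0 := fun i =>
    (Finset.sum_eq_zero_iff_of_nonpos (fun i _ => hle i)).1 hsum i (Finset.mem_univ i)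
  have hm : ∀ i, mi i (dg x) = 0 := by
    intro i
    refine ih (ωi i) (hωi i) 1 _ (one_pd _).1 (hdgi i x) (q1pos i) ?_ ?_
    · rw [← qy, hL i, mul_zero]
    · rw [← hmin, hz i, mul_zero]
  funext j
  obtain ⟨i, hi⟩ := exists_ne j
  obtain ⟨k, hk⟩ := Fin.exists_succAbove_eq hi.symm
  have := congrFun (congrFun (hm i) k) k
  simpa [mi, dg, hk] using this

lemma HRI_succ {n : ℕ} (ih : HR n) : HRI (n+1) := by
  intro ω hω
  refine ⟨ω 0, (hω 0).1, ?_⟩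
  intro B hB h1 h2
  obtain ⟨C, x, hC, hW, hX⟩ := simdiag (ω 0) B (hω 0) hB
  have hc : 0 < Complex.normSq C.det := Complex.normSq_pos.2 hC.ne_zero
  have hcons : (fun k => Cᴴ * ω k * C) =
      (Fin.cons 1 (fun k : Fin n => Cᴴ * ω k.succ * C) : Fin (n+1) → Mat (n+3)) := by
    funext k
    refine Fin.cases ?_ (fun k => ?_) k
    · simpa using hW
    · simp
  have e1 := q_congr ω (ω 0) B C
  have e2 := q_congr ω B B C
  rw [hcons, hX] at e1 e2
  rw [hW] at e1
  have hx := step_norm ih (fun k : Fin n => Cᴴ * ω k.succ * C) (fun k => posdef_congr (hω _) hC) x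
    (by rw [e1, h1, mul_zero]) (by rw [e2]; positivity)
  rw [hx] at hX
  have hX0 : Cᴴ * B * C = 0 := by rw [hX]; simp
  have hCu : IsUnit C := (Matrix.isUnit_iff_isUnit_det _).2 hC
  have hCu' : IsUnit Cᴴ := (Matrix.isUnit_conjTranspose C).2 hCu
  rwa [hCu.mul_left_eq_zero, hCu'.mul_right_eq_zero] at hX0

lemma HR_all (n : ℕ) : HR n := by
  induction n with
  | zero => exact HR_of_HRI HRI_zero
  | succ n ih => exact HR_of_HRI (HRI_succ ih)

end MixAux

theorem stmt15 {n : ℕ} (ω : Fin n → Matrix (Fin (n + 2)) (Fin (n + 2)) ℂ)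
    (hω : ∀ i, (ω i).PosDef)
    (A B : Matrix (Fin (n + 2)) (Fin (n + 2)) ℂ)
    (hA : A.IsHermitian) (hB : B.IsHermitian)
    (hAA : 0 < mixedDisc2 ω A A) :
    (mixedDisc2 ω A B) ^ 2 = mixedDisc2 ω A A * mixedDisc2 ω B B ↔
      ∃ s t : ℝ, (s ≠ 0 ∨ t ≠ 0) ∧ s • A + t • B = 0 := by
  simp only [MixAux.mixedDisc2_eq] at hAA ⊢
  constructor
  · intro h
    have hz := MixAux.HR_all n ω hω A (MixAux.q ω A A • B - MixAux.q ω A B • A) hA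
      ((MixAux.herm_smul hB _).sub (MixAux.herm_smul hA _)) hAA
      (by rw [MixAux.q_sub_right, MixAux.q_smul_right, MixAux.q_smul_right]; ring)
      (by
        simp only [MixAux.q_sub_right, MixAux.q_smul_right, MixAux.q_sub_left, MixAux.q_smul_left,
          MixAux.q_symm ω B A]
        apply le_of_eq
        linear_combination MixAux.q ω A A * h)
    refine ⟨-MixAux.q ω A B, MixAux.q ω A A, Or.inr hAA.ne', ?_⟩
    rw [neg_smul, neg_add_eq_sub]
    exact hz
  · rintro ⟨s, t, hst, h⟩
    have ht : t ≠ 0 := by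
      rintro rfl
      have hs : s ≠ 0 := by simpa using hst
      rw [zero_smul, add_zero, smul_eq_zero] at h
      have hA0 : A = 0 := h.resolve_left hs
      rw [hA0, MixAux.q_zero_left] at hAA
      exact lt_irrefl _ hAA
    have e1 : s * MixAux.q ω A A + t * MixAux.q ω A B = 0 := by
      rw [← MixAux.q_smul_right, ← MixAux.q_smul_right, ← MixAux.q_add_right, h, MixAux.q_symm,
        MixAux.q_zero_left]
    have e2 : s * MixAux.q ω A B + t * MixAux.q ω B B = 0 := by
      rw [MixAux.q_symm ω A B, ← MixAux.q_smul_right, ← MixAux.q_smul_right, ← MixAux.q_add_right, h,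
        MixAux.q_symm, MixAux.q_zero_left]
    apply mul_left_cancel₀ ht
    linear_combination MixAux.q ω A B * e1 - MixAux.q ω A A * e2
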